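/- If S is a Segre collection, then for every two distinct elements a, b of Fin 6 there is exactly one matching σ ∈ S with σ a = b; in other words, the five matchings of S together use each of the 15 two-element subsets of Fin 6 exactly once. -/

import Mathlib

/-- A matching of `Fin 6`: a fixed-point-free involution. -/
def IsMatching (σ : Equiv.Perm (Fin 6)) : Prop :=
  (∀ x, σ (σ x) = x) ∧ ∀ x, σ x ≠ x

/-- Two matchings are disjoint if they share no pair. -/
def DisjointMatchings (σ τ : Equiv.Perm (Fin 6)) : Prop :=
  ∀ x, σ x ≠ τ x

/-- A Segre collection: a set of five pairwise disjoint matchings of `Fin 6`. -/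
def IsSegreCollection (S : Finset (Equiv.Perm (Fin 6))) : Prop :=
  S.card = 5 ∧ (∀ σ ∈ S, IsMatching σ) ∧
    ∀ σ ∈ S, ∀ τ ∈ S, σ ≠ τ → DisjointMatchings σ τ

/-- In a Segre collection, every pair `{a, b}` of distinct elements of `Fin 6` is a pair
of exactly one of the five matchings. -/
theorem segre_collection_covers_pairs (S : Finset (Equiv.Perm (Fin 6)))
    (hS : IsSegreCollection S) :
    ∀ a b : Fin 6, a ≠ b → ∃! σ, σ ∈ S ∧ σ a = b := by
  obtain ⟨hcard, hm, hd⟩ := hS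
  intro a b hab
  have hinj : Set.InjOn (fun σ : Equiv.Perm (Fin 6) => σ a) (S : Set (Equiv.Perm (Fin 6))) := by
    intro σ hσ τ hτ h
    by_contra hne
    exact hd σ hσ τ hτ hne a h
  have himg : S.image (fun σ : Equiv.Perm (Fin 6) => σ a) = Finset.univ.erase a := by
    apply Finset.eq_of_subset_of_card_le
    · intro x hx
      obtain ⟨σ, hσ, rfl⟩ := Finset.mem_image.mp hx
      exact Finset.mem_erase.mpr ⟨(hm σ hσ).2 a, Finset.mem_univ _⟩
    · rw [Finset.card_image_of_injOn hinj, hcard, Finset.card_erase_of_mem (Finset.mem_univ a)]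
      simp
  have hb : b ∈ S.image (fun σ : Equiv.Perm (Fin 6) => σ a) := by
    rw [himg]
    exact Finset.mem_erase.mpr ⟨hab.symm, Finset.mem_univ _⟩
  obtain ⟨σ, hσ, h⟩ := Finset.mem_image.mp hb
  exact ⟨σ, ⟨hσ, h⟩, fun τ hτ => hinj hτ.1 hσ (hτ.2.trans h.symm)⟩
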